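/- Let B₀ > 0 and let Ψ₁ : ℝ² → ℝ be a smooth bounded function with bounded derivatives; set Ψ(x) = B₀|x|²/4 + Ψ₁(x) and osc Ψ₁ = sup Ψ₁ − inf Ψ₁. Then for every smooth compactly supported u : ℝ² → ℂ one has 4∫_{ℝ²} |∂(e^{-Ψ(x)} u(x))|² e^{2Ψ(x)} dx ≥ 2B₀ e^{-2 osc Ψ₁} ∫_{ℝ²} |u(x)|² dx. -/

import Mathlib

open MeasureTheory

/-- The Wirtinger derivative ∂ = ½(∂₁ − i∂₂) of a function on ℝ². -/
noncomputable def wirtingerD (f : EuclideanSpace ℝ (Fin 2) → ℂ)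
    (x : EuclideanSpace ℝ (Fin 2)) : ℂ :=
  (fderiv ℝ f x (EuclideanSpace.single 0 1)
    - Complex.I * fderiv ℝ f x (EuclideanSpace.single 1 1)) / 2

abbrev PE := EuclideanSpace ℝ (Fin 2)

lemma pg_int_zero (F : PE → ℝ) (hF : ContDiff ℝ 1 F) (hs : HasCompactSupport F) (v : PE) :
    ∫ x, fderiv ℝ F x v = 0 := by
  have hd : Continuous fun x => fderiv ℝ F x v :=
    (hF.continuous_fderiv (by norm_num)).clm_apply continuous_const
  have h := integral_mul_fderiv_eq_neg_fderiv_mul_of_integrable (μ := (volume : Measure PE))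
    (f := fun _ : PE => (1 : ℝ)) (g := F) (v := v) (by simp)
    (by simpa using hd.integrable_of_hasCompactSupport (hs.fderiv_apply ℝ v))
    (by simpa using hF.continuous.integrable_of_hasCompactSupport hs)
    (fun x _ => differentiableAt_const _)
    (fun x _ => hF.differentiable (by norm_num) x)
  simpa using h

lemma pg_comm (p : PE → ℝ) (hp : ContDiff ℝ (⊤ : ℕ∞) p) (x a b : PE) :
    fderiv ℝ (fun y => fderiv ℝ p y a) x b = fderiv ℝ (fun y => fderiv ℝ p y b) x a := by
  have h1 : DifferentiableAt ℝ (fderiv ℝ p) x :=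
    (hp.fderiv_right (m := (⊤ : ℕ∞)) (by simp)).differentiable (by simp) x
  have hs : IsSymmSndFDerivAt ℝ p x :=
    (contDiff_infty.1 hp 2).contDiffAt.isSymmSndFDerivAt (by simp)
  rw [fderiv_clm_apply h1 (differentiableAt_const _), fderiv_clm_apply h1 (differentiableAt_const _)]
  simpa using hs b a

lemma pg_smooth_fd (p : PE → ℝ) (hp : ContDiff ℝ (⊤ : ℕ∞) p) (a : PE) :
    ContDiff ℝ (⊤ : ℕ∞) (fun y => fderiv ℝ p y a) :=
  (hp.fderiv_right (m := (⊤ : ℕ∞)) (by simp)).clm_apply contDiff_const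

lemma pg_coord_fd (i : Fin 2) (x v : PE) : HasFDerivAt (fun y : PE => y i)
    (EuclideanSpace.proj i : PE →L[ℝ] ℝ) x :=
  (EuclideanSpace.proj i : PE →L[ℝ] ℝ).hasFDerivAt

noncomputable def pgN (B : ℝ) (p q : PE → ℝ) (x : PE) : ℝ :=
  (fderiv ℝ p x (EuclideanSpace.single 0 1) + fderiv ℝ q x (EuclideanSpace.single 1 1)
    - B / 2 * (x 0 * p x + x 1 * q x)) ^ 2 +
  (fderiv ℝ q x (EuclideanSpace.single 0 1) - fderiv ℝ p x (EuclideanSpace.single 1 1)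
    - B / 2 * (x 0 * q x - x 1 * p x)) ^ 2

lemma pg_cs_zero {p : PE → ℝ} (hs : HasCompactSupport p) {x : PE} (hx : x ∉ tsupport p) :
    p x = 0 ∧ fderiv ℝ p x = 0 := by
  refine ⟨image_eq_zero_of_notMem_tsupport hx, ?_⟩
  by_contra h
  exact hx (support_fderiv_subset ℝ h)

lemma pgN_cont (B : ℝ) (p q : PE → ℝ) (hp : ContDiff ℝ (⊤ : ℕ∞) p) (hq : ContDiff ℝ (⊤ : ℕ∞) q) :
    Continuous (pgN B p q) := by
  have a1 := (pg_smooth_fd p hp (EuclideanSpace.single 0 1)).continuous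
  have a2 := (pg_smooth_fd p hp (EuclideanSpace.single 1 1)).continuous
  have a3 := (pg_smooth_fd q hq (EuclideanSpace.single 0 1)).continuous
  have a4 := (pg_smooth_fd q hq (EuclideanSpace.single 1 1)).continuous
  have a5 := hp.continuous
  have a6 := hq.continuous
  unfold pgN
  fun_prop

lemma pgN_cs (B : ℝ) (p q : PE → ℝ) (hp : HasCompactSupport p) (hq : HasCompactSupport q) :
    HasCompactSupport (pgN B p q) := by
  refine HasCompactSupport.intro (hp.isCompact.union hq.isCompact) fun x hx => ?_
  simp only [Set.mem_union, not_or] at hx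
  obtain ⟨h1, h2⟩ := pg_cs_zero hp hx.1
  obtain ⟨h3, h4⟩ := pg_cs_zero hq hx.2
  simp [pgN, h1, h2, h3, h4]

lemma pg_main (B : ℝ) (p q : PE → ℝ) (hp : ContDiff ℝ (⊤ : ℕ∞) p) (hq : ContDiff ℝ (⊤ : ℕ∞) q)
    (hps : HasCompactSupport p) (hqs : HasCompactSupport q) :
    2 * B * ∫ x, (p x ^ 2 + q x ^ 2) ≤ ∫ x, pgN B p q x := by
  set e0 : PE := EuclideanSpace.single 0 1 with he0
  set e1 : PE := EuclideanSpace.single 1 1 with he1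
  have a1 := pg_smooth_fd p hp e0
  have a2 := pg_smooth_fd p hp e1
  have a3 := pg_smooth_fd q hq e0
  have a4 := pg_smooth_fd q hq e1
  have x0 : ContDiff ℝ (⊤ : ℕ∞) (fun y : PE => y 0) :=
    (EuclideanSpace.proj 0 : PE →L[ℝ] ℝ).contDiff
  have x1 : ContDiff ℝ (⊤ : ℕ∞) (fun y : PE => y 1) :=
    (EuclideanSpace.proj 1 : PE →L[ℝ] ℝ).contDiff
  let F1 : PE → ℝ := fun x => 2 * (p x * fderiv ℝ q x e1 - q x * fderiv ℝ p x e1)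
    - B * (x 0 * (p x * p x + q x * q x))
  let F2 : PE → ℝ := fun x => 2 * (q x * fderiv ℝ p x e0 - p x * fderiv ℝ q x e0)
    - B * (x 1 * (p x * p x + q x * q x))
  have hF1 : ContDiff ℝ (⊤ : ℕ∞) F1 := 
    (contDiff_const.mul ((hp.mul a4).sub (hq.mul a2))).sub
      (contDiff_const.mul (x0.mul ((hp.mul hp).add (hq.mul hq))))
  have hF2 : ContDiff ℝ (⊤ : ℕ∞) F2 := 
    (contDiff_const.mul ((hq.mul a1).sub (hp.mul a3))).sub
      (contDiff_const.mul (x1.mul ((hp.mul hp).add (hq.mul hq))))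
  have hF1s : HasCompactSupport F1 := by
    refine HasCompactSupport.intro (hps.isCompact.union hqs.isCompact) fun x hx => ?_
    simp only [Set.mem_union, not_or] at hx
    obtain ⟨h1, h2⟩ := pg_cs_zero hps hx.1
    obtain ⟨h3, h4⟩ := pg_cs_zero hqs hx.2
    simp [F1, h1, h2, h3, h4]
  have hF2s : HasCompactSupport F2 := by
    refine HasCompactSupport.intro (hps.isCompact.union hqs.isCompact) fun x hx => ?_
    simp only [Set.mem_union, not_or] at hx
    obtain ⟨h1, h2⟩ := pg_cs_zero hps hx.1
    obtain ⟨h3, h4⟩ := pg_cs_zero hqs hx.2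
    simp [F2, h1, h2, h3, h4]
  have hone : (1 : WithTop ℕ∞) ≤ ((⊤ : ℕ∞) : WithTop ℕ∞) := by exact_mod_cast le_top
  have i1 := pg_int_zero F1 (hF1.of_le hone) hF1s e0
  have i2 := pg_int_zero F2 (hF2.of_le hone) hF2s e1
  have hne : ((⊤ : ℕ∞) : WithTop ℕ∞) ≠ 0 := by simp
  have d1 : ∀ x, fderiv ℝ F1 x e0 + fderiv ℝ F2 x e1 =
      4 * (fderiv ℝ p x e0 * fderiv ℝ q x e1 - fderiv ℝ q x e0 * fderiv ℝ p x e1)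
      - 2 * B * (p x ^ 2 + q x ^ 2)
      - 2 * B * (x 0 * (p x * fderiv ℝ p x e0 + q x * fderiv ℝ q x e0)
        + x 1 * (p x * fderiv ℝ p x e1 + q x * fderiv ℝ q x e1)) := by
    intro x
    have P := (hp.differentiable hne x).hasFDerivAt
    have Q := (hq.differentiable hne x).hasFDerivAt
    have A1 := (a1.differentiable hne x).hasFDerivAt
    have A2 := (a2.differentiable hne x).hasFDerivAt
    have A3 := (a3.differentiable hne x).hasFDerivAt
    have A4 := (a4.differentiable hne x).hasFDerivAt
    have X0 := pg_coord_fd 0 x x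
    have X1 := pg_coord_fd 1 x x
    have D1 : HasFDerivAt F1 _ x := (((P.mul A4).sub (Q.mul A2)).const_mul 2).sub
      ((X0.mul ((P.mul P).add (Q.mul Q))).const_mul B)
    have D2 : HasFDerivAt F2 _ x := (((Q.mul A1).sub (P.mul A3)).const_mul 2).sub
      ((X1.mul ((P.mul P).add (Q.mul Q))).const_mul B)
    rw [D1.fderiv, D2.fderiv]
    have c1 := pg_comm p hp x e0 e1
    have c2 := pg_comm q hq x e0 e1
    have s00 : e0 0 = 1 := by simp [he0]
    have s11 : e1 1 = 1 := by simp [he1]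
    simp [c1, c2, s00, s11]
    ring
  have id1 : Integrable (fun x => fderiv ℝ F1 x e0) :=
    (pg_smooth_fd F1 hF1 e0).continuous.integrable_of_hasCompactSupport (hF1s.fderiv_apply ℝ e0)
  have id2 : Integrable (fun x => fderiv ℝ F2 x e1) :=
    (pg_smooth_fd F2 hF2 e1).continuous.integrable_of_hasCompactSupport (hF2s.fderiv_apply ℝ e1)
  have ipq : Integrable (fun x => p x ^ 2 + q x ^ 2) := by
    refine Continuous.integrable_of_hasCompactSupport
      ((hp.continuous.pow 2).add (hq.continuous.pow 2)) ?_
    refine HasCompactSupport.intro (hps.isCompact.union hqs.isCompact) fun x hx => ?_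
    simp only [Set.mem_union, not_or] at hx
    simp [(pg_cs_zero hps hx.1).1, (pg_cs_zero hqs hx.2).1]
  have iN : Integrable (pgN B p q) :=
    (pgN_cont B p q hp hq).integrable_of_hasCompactSupport (pgN_cs B p q hps hqs)
  have key : ∫ x, (2 * B * (p x ^ 2 + q x ^ 2) + (fderiv ℝ F1 x e0 + fderiv ℝ F2 x e1))
      ≤ ∫ x, pgN B p q x := by
    refine integral_mono ((ipq.const_mul _).add (id1.add id2)) iN fun x => ?_
    simp only [d1 x, pgN, ← he0, ← he1]
    nlinarith [sq_nonneg (fderiv ℝ p x e0 - fderiv ℝ q x e1 + B / 2 * (x 0 * p x - x 1 * q x)),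
      sq_nonneg (fderiv ℝ q x e0 + fderiv ℝ p x e1 + B / 2 * (x 0 * q x + x 1 * p x))]
  have id12 : Integrable (fun x => fderiv ℝ F1 x e0 + fderiv ℝ F2 x e1) := id1.add id2
  rw [integral_add (ipq.const_mul _) id12, integral_add id1 id2, i1, i2,
    integral_const_mul] at key
  linarith

lemma pg_wirt (B : ℝ) (w : PE → ℂ) (hw : ContDiff ℝ (⊤ : ℕ∞) w) (x : PE) :
    4 * ‖wirtingerD (fun y => (Real.exp (-(B * ‖y‖ ^ 2 / 4)) : ℂ) * w y) x‖ ^ 2 =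
    Real.exp (-2 * (B * ‖x‖ ^ 2 / 4)) * pgN B (fun y => (w y).re) (fun y => (w y).im) x := by
  have hne : ((⊤ : ℕ∞) : WithTop ℕ∞) ≠ 0 := by simp
  have W := (hw.differentiable hne x).hasFDerivAt
  have R := Complex.reCLM.hasFDerivAt.comp x W
  have I := Complex.imCLM.hasFDerivAt.comp x W
  have hn : HasFDerivAt (fun y : PE => -(B * ‖y‖ ^ 2 / 4)) _ x :=
    (((hasStrictFDerivAt_norm_sq x).hasFDerivAt.const_mul B).mul_const (1/4) |>.neg).congr_of_eventuallyEq
      (Filter.Eventually.of_forall fun y => by simp; ring)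
  have hE := Complex.ofRealCLM.hasFDerivAt.comp x hn.exp
  have hM : HasFDerivAt (fun y => (Real.exp (-(B * ‖y‖ ^ 2 / 4)) : ℂ) * w y) _ x := hE.mul W
  have hR : fderiv ℝ (fun y => (w y).re) x = _ := R.fderiv
  have hI : fderiv ℝ (fun y => (w y).im) x = _ := I.fderiv
  rw [wirtingerD, hM.fderiv, pgN, hR, hI, ← Complex.normSq_eq_norm_sq]
  have he : Real.exp (-2 * (B * ‖x‖ ^ 2 / 4)) = Real.exp (-(B * ‖x‖ ^ 2 / 4)) ^ 2 := by
    rw [← Real.exp_nat_mul]; congr 1; push_cast; ring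
  rw [he]
  simp [Complex.normSq_apply, EuclideanSpace.inner_single_right, -Complex.ofReal_exp]
  ring

theorem pauli_spectral_gap_variable_field (B₀ : ℝ) (hB₀ : 0 < B₀)
    (Ψ₁ : EuclideanSpace ℝ (Fin 2) → ℝ)
    (hΨ₁ : ContDiff ℝ (⊤ : ℕ∞) Ψ₁)
    (hΨ₁bdd : ∀ k : ℕ, ∃ C : ℝ, ∀ x, ‖iteratedFDeriv ℝ k Ψ₁ x‖ ≤ C)
    (u : EuclideanSpace ℝ (Fin 2) → ℂ)
    (hu : ContDiff ℝ (⊤ : ℕ∞) u) (hsupp : HasCompactSupport u) :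
    4 * ∫ x, ‖wirtingerD
          (fun y => (Real.exp (-(B₀ * ‖y‖ ^ 2 / 4 + Ψ₁ y)) : ℂ) * u y) x‖ ^ 2
          * Real.exp (2 * (B₀ * ‖x‖ ^ 2 / 4 + Ψ₁ x))
    ≥ 2 * B₀ * Real.exp (-2 * ((⨆ x, Ψ₁ x) - ⨅ x, Ψ₁ x)) * ∫ x, ‖u x‖ ^ 2 := by
  obtain ⟨C, hC⟩ := hΨ₁bdd 0
  simp only [norm_iteratedFDeriv_zero, Real.norm_eq_abs] at hC
  have hsup : ∀ x, Ψ₁ x ≤ ⨆ x, Ψ₁ x := le_ciSup ⟨C, by rintro _ ⟨x, rfl⟩; exact (abs_le.1 (hC x)).2⟩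
  have hinf : ∀ x, ⨅ x, Ψ₁ x ≤ Ψ₁ x := ciInf_le ⟨-C, by rintro _ ⟨x, rfl⟩; exact (abs_le.1 (hC x)).1⟩
  set S := ⨆ x, Ψ₁ x
  set J := ⨅ x, Ψ₁ x
  let w : PE → ℂ := fun y => (Real.exp (-Ψ₁ y) : ℂ) * u y
  have hw : ContDiff ℝ (⊤ : ℕ∞) w :=
    (Complex.ofRealCLM.contDiff.comp hΨ₁.neg.exp).mul hu
  have hws : HasCompactSupport w := hsupp.mul_left
  have hwf : (fun y => (Real.exp (-(B₀ * ‖y‖ ^ 2 / 4 + Ψ₁ y)) : ℂ) * u y) =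
      fun y => (Real.exp (-(B₀ * ‖y‖ ^ 2 / 4)) : ℂ) * w y := by
    funext y
    simp only [w]
    rw [← mul_assoc, ← Complex.ofReal_mul, ← Real.exp_add]
    congr 3; ring
  rw [hwf]
  set p : PE → ℝ := fun y => (w y).re with hpd
  set q : PE → ℝ := fun y => (w y).im with hqd
  have hp : ContDiff ℝ (⊤ : ℕ∞) p := Complex.reCLM.contDiff.comp hw
  have hq : ContDiff ℝ (⊤ : ℕ∞) q := Complex.imCLM.contDiff.comp hw
  have hps : HasCompactSupport p := hws.comp_left (g := Complex.re) rfl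
  have hqs : HasCompactSupport q := hws.comp_left (g := Complex.im) rfl
  have main := pg_main B₀ p q hp hq hps hqs
  have hL : ∀ x, 4 * (‖wirtingerD (fun y => (Real.exp (-(B₀ * ‖y‖ ^ 2 / 4)) : ℂ) * w y) x‖ ^ 2
      * Real.exp (2 * (B₀ * ‖x‖ ^ 2 / 4 + Ψ₁ x))) = Real.exp (2 * Ψ₁ x) * pgN B₀ p q x := by
    intro x
    rw [← mul_assoc, pg_wirt B₀ w hw x, mul_right_comm, ← Real.exp_add]
    congr 2; ring
  have iN : Integrable (pgN B₀ p q) :=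
    (pgN_cont B₀ p q hp hq).integrable_of_hasCompactSupport (pgN_cs B₀ p q hps hqs)
  have iN2 : Integrable (fun x => Real.exp (2 * Ψ₁ x) * pgN B₀ p q x) := by
    refine Continuous.integrable_of_hasCompactSupport ?_ (pgN_cs B₀ p q hps hqs).mul_left
    exact (Real.continuous_exp.comp (continuous_const.mul hΨ₁.continuous)).mul
      (pgN_cont B₀ p q hp hq)
  have iu : Integrable (fun x => ‖u x‖ ^ 2) := by
    refine Continuous.integrable_of_hasCompactSupport (hu.continuous.norm.pow 2) ?_
    exact hsupp.comp_left (g := fun z : ℂ => ‖z‖ ^ 2) (by simp)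
  have iw : Integrable (fun x => p x ^ 2 + q x ^ 2) := by
    refine Continuous.integrable_of_hasCompactSupport
      ((hp.continuous.pow 2).add (hq.continuous.pow 2)) ?_
    exact hws.comp_left (g := fun z : ℂ => z.re ^ 2 + z.im ^ 2) (by simp)
  rw [← integral_const_mul]
  simp_rw [hL]
  have s1 : Real.exp (2 * J) * ∫ x, pgN B₀ p q x ≤ ∫ x, Real.exp (2 * Ψ₁ x) * pgN B₀ p q x := by
    rw [← integral_const_mul]
    refine integral_mono (iN.const_mul _) iN2 fun x => ?_
    have : 0 ≤ pgN B₀ p q x := by unfold pgN; positivity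
    have h2 := hinf x
    dsimp only
    gcongr
  have s2 : Real.exp (-2 * S) * ∫ x, ‖u x‖ ^ 2 ≤ ∫ x, (p x ^ 2 + q x ^ 2) := by
    rw [← integral_const_mul]
    refine integral_mono (iu.const_mul _) iw fun x => ?_
    have e : p x ^ 2 + q x ^ 2 = Real.exp (-2 * Ψ₁ x) * ‖u x‖ ^ 2 := by
      have : p x ^ 2 + q x ^ 2 = ‖w x‖ ^ 2 := by
        rw [← Complex.normSq_eq_norm_sq, Complex.normSq_apply]; simp only [p, q]; ring
      rw [this]
      simp only [w]
      rw [norm_mul, mul_pow, Complex.norm_real, Real.norm_eq_abs, Real.abs_exp, ← Real.exp_nat_mul]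
      congr 2; push_cast; ring
    have h2 := hsup x
    dsimp only
    rw [e]
    refine mul_le_mul_of_nonneg_right (Real.exp_le_exp.2 (by linarith)) (by positivity)
  have hexp : Real.exp (-2 * (S - J)) = Real.exp (2 * J) * Real.exp (-2 * S) := by
    rw [← Real.exp_add]; congr 1; ring
  rw [hexp]
  calc 2 * B₀ * (Real.exp (2 * J) * Real.exp (-2 * S)) * ∫ x, ‖u x‖ ^ 2
      = Real.exp (2 * J) * (2 * B₀ * (Real.exp (-2 * S) * ∫ x, ‖u x‖ ^ 2)) := by ring
    _ ≤ Real.exp (2 * J) * (2 * B₀ * ∫ x, (p x ^ 2 + q x ^ 2)) := by gcongr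
    _ ≤ Real.exp (2 * J) * ∫ x, pgN B₀ p q x := by gcongr
    _ ≤ _ := s1
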